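/- There exists a non-degenerate ranking problem such that every ranking policy π maximizing the overall utility U(π) over all ranking policies satisfies U(π|DG) = 0 for some item group DG, even though there exists a ranking policy π' with U(π'|DG) > 0 for that item group. -/

import Mathlib

open Finset

/-- A ranking problem in a two-sided market: finite nonempty sets of items, intents,
user groups; a partition of the items into item groups; group proportions; per-group
intent distributions; a nonnegative relevance function; and a nonnegative exposure
function on positions with positive total exposure. -/
structure RankingProblem where
  Item : Type
  Intent : Type
  UserGrp : Type
  ItemGrp : Type
  [itemFin : Fintype Item]
  [itemDec : DecidableEq Item]
  [intentFin : Fintype Intent]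
  [userFin : Fintype UserGrp]
  [itemGrpFin : Fintype ItemGrp]
  [itemGrpDec : DecidableEq ItemGrp]
  [itemNe : Nonempty Item]
  [intentNe : Nonempty Intent]
  [userNe : Nonempty UserGrp]
  /-- group proportion of each user group -/
  ρ : UserGrp → ℝ
  ρ_nonneg : ∀ g, 0 ≤ ρ g
  ρ_sum : ∑ g, ρ g = 1
  /-- the item group of each item; this partitions the items, each group being nonempty -/
  grp : Item → ItemGrp
  grp_surj : Function.Surjective grp
  /-- intent distribution of each user group -/
  intentDist : UserGrp → Intent → ℝ
  intentDist_nonneg : ∀ g i, 0 ≤ intentDist g i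
  intentDist_sum : ∀ g, ∑ i, intentDist g i = 1
  /-- relevance of each item to each intent -/
  rel : Item → Intent → ℝ
  rel_nonneg : ∀ d i, 0 ≤ rel d i
  /-- exposure of each position -/
  expo : Fin (Fintype.card Item) → ℝ
  expo_nonneg : ∀ n, 0 ≤ expo n
  expo_sum_pos : 0 < ∑ n, expo n

attribute [instance] RankingProblem.itemFin RankingProblem.itemDec
  RankingProblem.intentFin RankingProblem.userFin RankingProblem.itemGrpFin
  RankingProblem.itemGrpDec RankingProblem.itemNe RankingProblem.intentNe
  RankingProblem.userNe

namespace RankingProblem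

variable (P : RankingProblem)

/-- A ranking is a bijection from items onto positions. -/
abbrev Ranking := P.Item ≃ Fin (Fintype.card P.Item)

/-- The overall intent distribution I_U(i) = Σ_UG ρ_UG · I_UG(i). -/
noncomputable def overallIntent (i : P.Intent) : ℝ := ∑ g, P.ρ g * P.intentDist g i

/-- Utility of a ranking for an intent: U(σ|i) = Σ_d e(σ(d))·r(d,i). -/
noncomputable def intentUtil (σ : P.Ranking) (i : P.Intent) : ℝ :=
  ∑ d, P.expo (σ d) * P.rel d i

/-- A ranking policy: a (finitely supported) probability distribution over rankings. -/
def IsPolicy (π : P.Ranking → ℝ) : Prop := (∀ σ, 0 ≤ π σ) ∧ ∑ σ, π σ = 1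

/-- Utility of a policy for a user group. -/
noncomputable def groupUtil (π : P.Ranking → ℝ) (g : P.UserGrp) : ℝ :=
  ∑ σ, π σ * ∑ i, P.intentDist g i * P.intentUtil σ i

/-- Overall utility of a policy. -/
noncomputable def utility (π : P.Ranking → ℝ) : ℝ := ∑ g, P.ρ g * P.groupUtil π g

/-- Utility of a policy for an item group. -/
noncomputable def itemGroupUtil (π : P.Ranking → ℝ) (dg : P.ItemGrp) : ℝ :=
  ∑ σ, π σ * ∑ i, P.overallIntent i *
    ∑ d ∈ univ.filter (fun d => P.grp d = dg), P.expo (σ d) * P.rel d i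

/-- Average exposure of an item group under a policy. -/
noncomputable def groupExposure (π : P.Ranking → ℝ) (dg : P.ItemGrp) : ℝ :=
  (∑ σ, π σ * ∑ d ∈ univ.filter (fun d => P.grp d = dg), P.expo (σ d)) /
    (univ.filter (fun d => P.grp d = dg)).card

/-- Expected relevance of an item to the whole user population. -/
noncomputable def expRel (d : P.Item) : ℝ := ∑ i, P.overallIntent i * P.rel d i

/-- Non-degeneracy of a ranking problem. -/
def NonDegenerate : Prop :=
  (∀ g, 0 < P.ρ g) ∧ (∀ i, 0 < P.overallIntent i) ∧
    (∀ i, ∃ d, 0 < P.rel d i) ∧ (∀ dg, ∃ d, P.grp d = dg ∧ 0 < P.expRel d)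

/-- The amount of intent covered by a ranking. -/
noncomputable def coverage (σ : P.Ranking) : ℝ :=
  ∑ i ∈ univ.filter (fun i => 0 < P.intentUtil σ i), P.overallIntent i

instance : Nonempty P.Ranking := ⟨Fintype.equivFin P.Item⟩

/-- The maximum amount of intent coverable by any ranking. -/
noncomputable def maxCoverage : ℝ := ⨆ σ : P.Ranking, P.coverage σ

/-- Items are ranked by expected relevance within each item group under π. -/
def RankedByExpRel (π : P.Ranking → ℝ) : Prop :=
  ∀ σ, 0 < π σ → ∀ dm dn, P.grp dm = P.grp dn → P.expRel dn < P.expRel dm →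
    P.expo (σ dn) ≤ P.expo (σ dm)

/-- User fairness of a policy with respect to a concave increasing function f. -/
noncomputable def userFairness (f : ℝ → ℝ) (π : P.Ranking → ℝ) : ℝ :=
  ∑ g, P.ρ g * f (P.groupUtil π g)

/-- Diversity of a single ranking with respect to a concave increasing function g. -/
noncomputable def rankDiversity (gf : ℝ → ℝ) (σ : P.Ranking) : ℝ :=
  ∑ i, P.overallIntent i * gf (P.intentUtil σ i)

/-- Diversity of a policy. -/
noncomputable def diversity (gf : ℝ → ℝ) (π : P.Ranking → ℝ) : ℝ :=
  ∑ σ, π σ * P.rankDiversity gf σ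

/-- π maximizes the overall utility over all ranking policies. -/
def MaxUtil (π : P.Ranking → ℝ) : Prop :=
  P.IsPolicy π ∧ ∀ π', P.IsPolicy π' → P.utility π' ≤ P.utility π

/-- π maximizes user fairness over all ranking policies. -/
def MaxUF (f : ℝ → ℝ) (π : P.Ranking → ℝ) : Prop :=
  P.IsPolicy π ∧ ∀ π', P.IsPolicy π' → P.userFairness f π' ≤ P.userFairness f π

/-- π maximizes diversity over all ranking policies. -/
def MaxDiv (gf : ℝ → ℝ) (π : P.Ranking → ℝ) : Prop :=
  P.IsPolicy π ∧ ∀ π', P.IsPolicy π' → P.diversity gf π' ≤ P.diversity gf π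

/-- π satisfies the disparate treatment constraints with merit function M. -/
def SatDT (M : P.ItemGrp → ℝ) (π : P.Ranking → ℝ) : Prop :=
  ∀ dg1 dg2, P.groupExposure π dg1 / M dg1 = P.groupExposure π dg2 / M dg2

/-- π maximizes overall utility among policies satisfying the disparate treatment
constraints with merit function M. -/
def MaxUtilDT (M : P.ItemGrp → ℝ) (π : P.Ranking → ℝ) : Prop :=
  P.IsPolicy π ∧ P.SatDT M π ∧
    ∀ π', P.IsPolicy π' → P.SatDT M π' → P.utility π' ≤ P.utility π

/-- π dominates π' for the user groups. -/
def DominatesUsers (π π' : P.Ranking → ℝ) : Prop :=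
  (∀ g, P.groupUtil π' g ≤ P.groupUtil π g) ∧ ∃ g, P.groupUtil π' g < P.groupUtil π g

/-- π is Pareto efficient for the user groups. -/
def ParetoUsers (π : P.Ranking → ℝ) : Prop :=
  ¬ ∃ π', P.IsPolicy π' ∧ P.DominatesUsers π' π

/-- σ dominates σ' for the intents. -/
def DominatesIntents (σ σ' : P.Ranking) : Prop :=
  (∀ i, P.intentUtil σ' i ≤ P.intentUtil σ i) ∧ ∃ i, P.intentUtil σ' i < P.intentUtil σ i

/-- σ is Pareto efficient for the intents. -/
def ParetoIntents (σ : P.Ranking) : Prop := ¬ ∃ σ', P.DominatesIntents σ' σ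

end RankingProblem
/-- Two items, one intent, one user group; relevances 2 and 1; only the first position
has exposure; each item is its own group. -/
noncomputable def exProblem : RankingProblem where
  Item := Fin 2
  Intent := Unit
  UserGrp := Unit
  ItemGrp := Fin 2
  ρ := fun _ => 1
  ρ_nonneg := fun _ => zero_le_one
  ρ_sum := by simp
  grp := id
  grp_surj := Function.surjective_id
  intentDist := fun _ _ => 1
  intentDist_nonneg := fun _ _ => zero_le_one
  intentDist_sum := by simp
  rel := fun d _ => if d = 0 then 2 else 1
  rel_nonneg := fun d _ => by split_ifs <;> norm_num
  expo := fun n => if n.val = 0 then 1 else 0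
  expo_nonneg := fun n => by split_ifs <;> norm_num
  expo_sum_pos := by
    show 0 < ∑ n : Fin 2, (if n.val = 0 then (1 : ℝ) else 0)
    simp

/-- The two exposures add up to one under any bijection. -/
lemma ex_sum (σ : Fin 2 ≃ Fin 2) :
    (if (σ 0).val = 0 then (1 : ℝ) else 0) + (if (σ 1).val = 0 then (1 : ℝ) else 0) = 1 := by
  have h := Equiv.sum_comp σ (fun n : Fin 2 => if n.val = 0 then (1 : ℝ) else 0)
  rw [Fin.sum_univ_two, Fin.sum_univ_two] at h
  simpa using h

lemma ex_utility (π : exProblem.Ranking → ℝ) :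
    exProblem.utility π =
      ∑ σ : Fin 2 ≃ Fin 2, π σ * ((if (σ 0).val = 0 then (1 : ℝ) else 0) * 2
        + (if (σ 1).val = 0 then (1 : ℝ) else 0)) := by
  show ∑ g : Unit, (1 : ℝ) * ∑ σ : Fin 2 ≃ Fin 2, π σ * ∑ i : Unit, (1 : ℝ) *
    ∑ d : Fin 2, (if (σ d).val = 0 then (1 : ℝ) else 0) * (if d = 0 then 2 else 1) = _
  simp [Fin.sum_univ_two]

lemma ex_item (π : exProblem.Ranking → ℝ) :
    exProblem.itemGroupUtil π (1 : Fin 2) =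
      ∑ σ : Fin 2 ≃ Fin 2, π σ * (if (σ 1).val = 0 then (1 : ℝ) else 0) := by
  show ∑ σ : Fin 2 ≃ Fin 2, π σ * ∑ i : Unit, (∑ g : Unit, (1 : ℝ) * 1) *
    ∑ d ∈ univ.filter (fun d : Fin 2 => d = 1),
      (if (σ d).val = 0 then (1 : ℝ) else 0) * (if d = 0 then 2 else 1) = _
  simp [Finset.filter_eq']

lemma ex_rel (π : exProblem.Ranking → ℝ) (h : exProblem.IsPolicy π) :
    exProblem.utility π = 2 - exProblem.itemGroupUtil π (1 : Fin 2) := by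
  have h2 : ∑ σ : Fin 2 ≃ Fin 2, π σ = 1 := h.2
  rw [ex_utility, ex_item, eq_sub_iff_add_eq, ← Finset.sum_add_distrib]
  calc _ = ∑ σ : Fin 2 ≃ Fin 2, π σ * 2 := by
        refine Finset.sum_congr rfl fun σ _ => ?_
        linear_combination 2 * π σ * ex_sum σ
    _ = 2 := by
        have h3 := Finset.sum_mul (univ : Finset (Fin 2 ≃ Fin 2)) π 2
        linarith

/-- The deterministic policy at a given ranking. -/
noncomputable def exPure (τ : Fin 2 ≃ Fin 2) : exProblem.Ranking → ℝ :=
  fun σ : Fin 2 ≃ Fin 2 => if σ = τ then 1 else 0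

lemma exPure_policy (τ : Fin 2 ≃ Fin 2) : exProblem.IsPolicy (exPure τ) := by
  constructor
  · intro (σ : Fin 2 ≃ Fin 2)
    show (0 : ℝ) ≤ if σ = τ then 1 else 0
    split_ifs <;> norm_num
  · show ∑ σ : Fin 2 ≃ Fin 2, (if σ = τ then (1 : ℝ) else 0) = 1
    simp

lemma exPure_item (τ : Fin 2 ≃ Fin 2) :
    exProblem.itemGroupUtil (exPure τ) (1 : Fin 2) = if (τ 1).val = 0 then (1 : ℝ) else 0 := by
  rw [ex_item]
  show ∑ σ : Fin 2 ≃ Fin 2, (if σ = τ then (1 : ℝ) else 0) * _ = _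
  simp only [ite_mul, one_mul, zero_mul, Finset.sum_ite_eq', Finset.mem_univ, if_true]

/-- There exists a non-degenerate ranking problem such that every policy maximizing
overall utility gives zero utility to some item group, even though some policy gives
that item group positive utility. -/
theorem stmt4 :
    ∃ P : RankingProblem, P.NonDegenerate ∧
      ∀ π : P.Ranking → ℝ, P.MaxUtil π →
        ∃ dg, P.itemGroupUtil π dg = 0 ∧
          ∃ π' : P.Ranking → ℝ, P.IsPolicy π' ∧ 0 < P.itemGroupUtil π' dg := by
  refine ⟨exProblem, ⟨fun _ => one_pos, fun i => ?_, fun i => ⟨(0 : Fin 2), ?_⟩,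
    fun dg => ⟨dg, rfl, ?_⟩⟩, fun π hπ => ⟨(1 : Fin 2), ?_, exPure (Equiv.swap 0 1),
      exPure_policy _, ?_⟩⟩
  · show 0 < ∑ g : Unit, (1 : ℝ) * 1
    simp
  · show (0 : ℝ) < if (0 : Fin 2) = 0 then 2 else 1
    simp
  · show 0 < ∑ i : Unit, (∑ g : Unit, (1 : ℝ) * 1) * (if (show Fin 2 from dg) = 0 then 2 else 1)
    simp only [Finset.univ_unique, Finset.sum_singleton]
    split_ifs <;> norm_num
  · have h1 := hπ.2 _ (exPure_policy (Equiv.refl _))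
    rw [ex_rel _ hπ.1, ex_rel _ (exPure_policy _), exPure_item] at h1
    have h0 : 0 ≤ exProblem.itemGroupUtil π (1 : Fin 2) := by
      rw [ex_item]
      refine Finset.sum_nonneg fun σ _ => mul_nonneg (hπ.1.1 σ) ?_
      split_ifs <;> norm_num
    simp at h1
    exact le_antisymm h1 h0
  · rw [exPure_item]
    simp
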